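/- Let ℙ be a finitely characterized, stationary, ergodic process over a finite alphabet 𝒳 with positive-probability predictive equivalence classes E_1,…,E_N, and let T = Σ_{x∈𝒳} T^(x) be the state-to-state transition matrix of its history ε-machine. Then the distribution μ = (ℙ^-(E_1),…,ℙ^-(E_N)) is stationary for T: for every 1 ≤ j ≤ N, μ_j = Σ_{i=1}^N μ_i T_{ij}. -/

import Mathlib

open MeasureTheory Filter Topology
open scoped Classical

namespace EM

variable {X : Type*} [Fintype X] [MeasurableSpace X] [MeasurableSingletonClass X]

/-- The left shift on bi-infinite sequences. -/
def shift (ω : ℤ → X) : ℤ → X := fun n => ω (n + 1)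

/-- ℙ(w): probability of the cylinder set of the word `w` at position 0. -/
noncomputable def wordProb (μ : Measure (ℤ → X)) (w : List X) : ℝ :=
  (μ {ω | ∀ k : Fin w.length, ω ((k : ℕ) : ℤ) = w.get k}).toReal

/-- Stationarity: invariance of the measure under the shift. -/
def Stationary (μ : Measure (ℤ → X)) : Prop := Measure.map shift μ = μ

/-- Ergodicity: every shift-invariant measurable event is trivial. -/
def Ergodic' (μ : Measure (ℤ → X)) : Prop :=
  ∀ A : Set (ℤ → X), MeasurableSet A → shift ⁻¹' A = A → μ A = 0 ∨ μ A = 1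

/-- Projection of a bi-infinite sequence to its past:  (pastMap ω) n = x_{-(n+1)}. -/
def pastMap (ω : ℤ → X) : ℕ → X := fun n => ω (-((n : ℤ) + 1))

/-- ℙ⁻ : the marginal of ℙ on past sequences. -/
noncomputable def pastMeasure (μ : Measure (ℤ → X)) : Measure (ℕ → X) :=
  Measure.map pastMap μ

/-- x⃖^t = x_{-t} … x_{-1}, the last `t` symbols of the past `p`, as a word. -/
def pastWord (p : ℕ → X) (t : ℕ) : List X := (List.range t).reverse.map p

/-- A past is nontrivial if all of its finite suffixes have positive probability. -/
def Nontrivial' (μ : Measure (ℤ → X)) (p : ℕ → X) : Prop :=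
  ∀ t : ℕ, 0 < wordProb μ (pastWord p t)

/-- ℙ(w | v) = ℙ(vw)/ℙ(v): conditional probability that `w` follows `v`. -/
noncomputable def condProb (μ : Measure (ℤ → X)) (w v : List X) : ℝ :=
  wordProb μ (v ++ w) / wordProb μ v

/-- A past is `w`-regular if it is nontrivial and lim_{t→∞} ℙ(w|x⃖^t) exists. -/
def WRegular (μ : Measure (ℤ → X)) (p : ℕ → X) (w : List X) : Prop :=
  Nontrivial' μ p ∧ ∃ L : ℝ, Tendsto (fun t => condProb μ w (pastWord p t)) atTop (𝓝 L)

/-- A past is regular if it is nontrivial and `w`-regular for every nonempty word `w`. -/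
def Regular (μ : Measure (ℤ → X)) (p : ℕ → X) : Prop :=
  Nontrivial' μ p ∧ ∀ w : List X, w ≠ [] →
    ∃ L : ℝ, Tendsto (fun t => condProb μ w (pastWord p t)) atTop (𝓝 L)

/-- 𝐏(w|x⃖) = lim_{t→∞} ℙ(w|x⃖^t)  (meaningful for regular pasts). -/
noncomputable def predProb (μ : Measure (ℤ → X)) (p : ℕ → X) (w : List X) : ℝ :=
  limUnder atTop (fun t => condProb μ w (pastWord p t))

/-- The past x⃖x obtained by appending the symbol `x` to the past x⃖. -/
def extendPast (p : ℕ → X) (x : X) : ℕ → X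
  | 0 => x
  | n + 1 => p n

/-- The past obtained by appending a word symbol by symbol. -/
def extendWord (p : ℕ → X) : List X → (ℕ → X)
  | [] => p
  | x :: u => extendWord (extendPast p x) u

/-- The predictive equivalence class of the (regular) past `p`. -/
def classOf (μ : Measure (ℤ → X)) (p : ℕ → X) : Set (ℕ → X) :=
  {q | Regular μ q ∧ ∀ w : List X, w ≠ [] → predProb μ q w = predProb μ p w}

section HMM

variable {S : Type*} [Fintype S] [DecidableEq S]

/-- T^(w) = T^(w₀) ⋯ T^(w_{l-1}). -/
def wordMatrix (T : X → Matrix S S ℝ) (w : List X) : Matrix S S ℝ :=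
  (w.map T).prod

/-- 𝐏_{σ_i}(w) = ‖e_i T^(w)‖₁, the probability of emitting `w` from state `i`. -/
noncomputable def stateWordProb (T : X → Matrix S S ℝ) (i : S) (w : List X) : ℝ :=
  ∑ j, wordMatrix T w i j

/-- All transition matrices have nonnegative entries. -/
def HMMNonneg (T : X → Matrix S S ℝ) : Prop := ∀ x i j, 0 ≤ T x i j

/-- The overall transition matrix T = Σ_x T^(x) is row-stochastic. -/
def HMMStochastic (T : X → Matrix S S ℝ) : Prop := ∀ i, ∑ x : X, ∑ j, T x i j = 1

/-- The overall state-to-state transition matrix T = Σ_x T^(x). -/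
noncomputable def totalT (T : X → Matrix S S ℝ) : Matrix S S ℝ := ∑ x : X, T x

/-- Irreducibility: the directed graph with an edge i → j whenever T_{ij} > 0 is
strongly connected. -/
def Irreducible' (T : X → Matrix S S ℝ) : Prop :=
  ∀ i j : S, ∃ n : ℕ, 0 < n ∧ 0 < (totalT T ^ n) i j

/-- Unifilarity: from each state, each symbol leads to at most one state. -/
def Unifilar (T : X → Matrix S S ℝ) : Prop :=
  ∀ (x : X) (i j k : S), 0 < T x i j → 0 < T x i k → j = k

/-- Probabilistically distinct states. -/
def ProbDistinct (T : X → Matrix S S ℝ) : Prop :=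
  ∀ i j : S, i ≠ j → ∃ w : List X, w ≠ [] ∧ stateWordProb T i w ≠ stateWordProb T j w

/-- π is a stationary distribution for the HMM: π ≥ 0, Σπ = 1, π = πT. -/
def IsStationaryDist (T : X → Matrix S S ℝ) (π : S → ℝ) : Prop :=
  (∀ i, 0 ≤ π i) ∧ (∑ i, π i = 1) ∧ (∀ j, ∑ i, π i * totalT T i j = π j)

/-- A generator ε-machine: a valid, irreducible, unifilar HMM with
probabilistically distinct states. -/
def IsGenEM (T : X → Matrix S S ℝ) : Prop :=
  HMMNonneg T ∧ HMMStochastic T ∧ Irreducible' T ∧ Unifilar T ∧ ProbDistinct T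

/-- The set of regular pasts whose predictions agree with state `i` of the HMM `T`. -/
def stateClass (μ : Measure (ℤ → X)) (T : X → Matrix S S ℝ) (i : S) : Set (ℕ → X) :=
  {q | Regular μ q ∧ ∀ w : List X, w ≠ [] → predProb μ q w = stateWordProb T i w}

end HMM

/-- The symbol-labeled transition matrices of the history ε-machine, given
representatives `p i` of the positive-probability predictive equivalence classes:
T^(x)_{ij} = 𝐏(x|E_i) if 𝐏(x|E_i) > 0 and δ_h(E_i,x) = E_j, and 0 otherwise. -/
noncomputable def histT (μ : Measure (ℤ → X)) {N : ℕ} (p : Fin N → (ℕ → X)) (x : X) :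
    Matrix (Fin N) (Fin N) ℝ := fun i j =>
  if 0 < predProb μ (p i) [x] ∧ classOf μ (extendPast (p i) x) = classOf μ (p j)
  then predProb μ (p i) [x] else 0

/-- ℙ is finitely characterized, with the pasts `p i` representing the finitely many
positive-probability predictive equivalence classes E_i = classOf μ (p i). -/
def FinitelyCharacterized (μ : Measure (ℤ → X)) {N : ℕ} (p : Fin N → (ℕ → X)) : Prop :=
  (∀ i, Regular μ (p i)) ∧
  (∀ i j : Fin N, i ≠ j → classOf μ (p i) ≠ classOf μ (p j)) ∧
  (∀ i, 0 < pastMeasure μ (classOf μ (p i))) ∧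
  (∑ i, pastMeasure μ (classOf μ (p i)) = 1)

end EM

namespace EM

section Helpers

variable {X : Type*}

/-- Sequences in which the word `w` occurs at position `-n`. -/
def cyl (w : List X) (n : ℕ) : Set (ℤ → X) :=
  {ω | ∀ k : Fin w.length, ω (((k : ℕ) : ℤ) - n) = w.get k}

/-- The first `t` coordinates of a past. -/
def initialSegment (t : ℕ) (q : ℕ → X) : Fin t → X := fun k => q k

lemma pastWord_length (q : ℕ → X) (t : ℕ) : (pastWord q t).length = t := by
  simp [pastWord]

lemma pastWord_get (q : ℕ → X) (t k : ℕ) (h : k < (pastWord q t).length) :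
    (pastWord q t)[k] = q (t - 1 - k) := by
  simp [pastWord]

lemma pastWord_eq_ofFn (q : ℕ → X) (t : ℕ) :
    pastWord q t = (List.ofFn (initialSegment t q)).reverse := by
  apply List.ext_getElem
  · simp [pastWord]
  · intro k h1 h2
    simp [pastWord, initialSegment]

lemma pastWord_extendPast (q : ℕ → X) (x : X) (t : ℕ) :
    pastWord (extendPast q x) (t + 1) = pastWord q t ++ [x] := by
  unfold pastWord
  rw [List.range_succ_eq_map]
  simp [extendPast, Function.comp_def]

lemma pastMap_shift (ω : ℤ → X) : pastMap (shift ω) = extendPast (pastMap ω) (ω 0) := by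
  funext n
  cases n with
  | zero => simp [pastMap, shift, extendPast]
  | succ n =>
    simp only [pastMap, shift, extendPast]
    congr 1

lemma mem_cyl_pastWord (q : ℕ → X) (t : ℕ) (ω : ℤ → X) :
    ω ∈ cyl (pastWord q t) t ↔ initialSegment t (pastMap ω) = initialSegment t q := by
  constructor
  · intro h
    funext k
    have hk := h ⟨t - 1 - k, by rw [pastWord_length]; omega⟩
    simp only [List.get_eq_getElem, pastWord_get] at hk
    simp only [initialSegment, pastMap]
    have e1 : ((t - 1 - (k : ℕ) : ℕ) : ℤ) - t = -(((k : ℕ) : ℤ) + 1) := by omega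
    have e2 : t - 1 - (t - 1 - (k : ℕ)) = k := by omega
    rw [e1, e2] at hk
    exact hk
  · rintro h ⟨k, hk⟩
    have hk' : k < t := by rwa [pastWord_length] at hk
    have h1 := congrFun h ⟨t - 1 - k, by omega⟩
    simp only [initialSegment, pastMap] at h1
    simp only [List.get_eq_getElem, pastWord_get]
    rw [← h1]
    congr 1
    omega

lemma mem_cyl_append (v w : List X) (n : ℕ) (ω : ℤ → X) (hn : v.length = n) :
    ω ∈ cyl (v ++ w) n ↔ ω ∈ cyl v n ∧ ω ∈ cyl w 0 := by
  subst hn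
  constructor
  · intro h
    refine ⟨fun k => ?_, fun k => ?_⟩
    · have := h ⟨k, by simp; omega⟩
      simpa [List.getElem_append_left] using this
    · have := h ⟨v.length + k, by simp⟩
      simpa [List.getElem_append_right] using this
  · rintro ⟨h1, h2⟩ ⟨k, hk⟩
    by_cases hkv : k < v.length
    · simpa [List.getElem_append_left, hkv] using h1 ⟨k, hkv⟩
    · have hk2 : k - v.length < w.length := by
        simp at hk
        omega
      have := h2 ⟨k - v.length, hk2⟩
      simp only [List.get_eq_getElem, Nat.cast_zero, sub_zero] at this ⊢
      rw [List.getElem_append_right (by omega), ← this]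
      congr 1
      omega

lemma mem_cyl_singleton (x : X) (ω : ℤ → X) : ω ∈ cyl [x] 0 ↔ ω 0 = x := by
  simp [cyl]

lemma totalT_apply {S : Type*} [Fintype X] [Fintype S] (T : X → Matrix S S ℝ) (i j : S) :
    totalT T i j = ∑ x, T x i j := by
  simp [totalT, Matrix.sum_apply]

variable [MeasurableSpace X]

lemma measurable_shift : Measurable (shift : (ℤ → X) → ℤ → X) :=
  measurable_pi_lambda _ fun _ => measurable_pi_apply _

lemma measurable_pastMap : Measurable (pastMap : (ℤ → X) → ℕ → X) :=
  measurable_pi_lambda _ fun _ => measurable_pi_apply _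

lemma measurable_initialSegment (t : ℕ) :
    Measurable (initialSegment t : (ℕ → X) → Fin t → X) :=
  measurable_pi_lambda _ fun _ => measurable_pi_apply _

lemma measurable_extendPast (x : X) : Measurable (fun q : ℕ → X => extendPast q x) := by
  refine measurable_pi_lambda _ fun n => ?_
  cases n with
  | zero => exact measurable_const
  | succ n => exact measurable_pi_apply n

lemma wordProb_nonneg (μ : Measure (ℤ → X)) (w : List X) : 0 ≤ wordProb μ w :=
  ENNReal.toReal_nonneg

lemma condProb_nonneg (μ : Measure (ℤ → X)) (w v : List X) : 0 ≤ condProb μ w v :=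
  div_nonneg (wordProb_nonneg _ _) (wordProb_nonneg _ _)

lemma Regular.tendsto {μ : Measure (ℤ → X)} {q : ℕ → X} (hq : Regular μ q) {w : List X}
    (hw : w ≠ []) :
    Tendsto (fun t => condProb μ w (pastWord q t)) atTop (𝓝 (predProb μ q w)) :=
  tendsto_nhds_limUnder (hq.2 w hw)

lemma Regular.predProb_nonneg {μ : Measure (ℤ → X)} {q : ℕ → X} (hq : Regular μ q) {w : List X}
    (hw : w ≠ []) : 0 ≤ predProb μ q w :=
  ge_of_tendsto' (hq.tendsto hw) fun _ => condProb_nonneg _ _ _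

lemma mem_classOf_iff {μ : Measure (ℤ → X)} {p q : ℕ → X} :
    q ∈ classOf μ p ↔ Nontrivial' μ q ∧ ∀ w : List X, w ≠ [] →
      Tendsto (fun t => condProb μ w (pastWord q t)) atTop (𝓝 (predProb μ p w)) := by
  constructor
  · rintro ⟨h1, h2⟩
    exact ⟨h1.1, fun w hw => h2 w hw ▸ h1.tendsto hw⟩
  · rintro ⟨h1, h2⟩
    exact ⟨⟨h1, fun w hw => ⟨_, h2 w hw⟩⟩, fun w hw => (h2 w hw).limUnder_eq⟩

lemma classOf_eq_of_mem {μ : Measure (ℤ → X)} {p q : ℕ → X} (h : q ∈ classOf μ p) :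
    classOf μ q = classOf μ p := by
  ext r
  constructor
  · exact fun hr => ⟨hr.1, fun w hw => (hr.2 w hw).trans (h.2 w hw)⟩
  · exact fun hr => ⟨hr.1, fun w hw => (hr.2 w hw).trans (h.2 w hw).symm⟩

lemma histT_nonneg (μ : Measure (ℤ → X)) {N : ℕ} (p : Fin N → (ℕ → X)) (x : X) (i j : Fin N) :
    0 ≤ histT μ p x i j := by
  unfold histT
  split_ifs with h
  · exact h.1.le
  · exact le_rfl

/-- The law of the past restricted to the event that the next symbol is `x`. -/
noncomputable def pastNextMeasure (μ : Measure (ℤ → X)) (x : X) : Measure (ℕ → X) :=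
  (μ.restrict {ω | ω 0 = x}).map pastMap

instance (μ : Measure (ℤ → X)) [IsProbabilityMeasure μ] :
    IsProbabilityMeasure (pastMeasure μ) :=
  Measure.isProbabilityMeasure_map measurable_pastMap.aemeasurable

instance (μ : Measure (ℤ → X)) [IsProbabilityMeasure μ] (x : X) :
    IsFiniteMeasure (pastNextMeasure μ x) := by
  unfold pastNextMeasure
  infer_instance

lemma pastNextMeasure_apply (μ : Measure (ℤ → X)) (x : X) {A : Set (ℕ → X)}
    (hA : MeasurableSet A) :
    pastNextMeasure μ x A = μ (pastMap ⁻¹' A ∩ {ω | ω 0 = x}) := by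
  rw [pastNextMeasure, Measure.map_apply measurable_pastMap hA,
    Measure.restrict_apply (measurable_pastMap hA)]

lemma pastMeasure_apply (μ : Measure (ℤ → X)) {A : Set (ℕ → X)} (hA : MeasurableSet A) :
    pastMeasure μ A = μ (pastMap ⁻¹' A) :=
  Measure.map_apply measurable_pastMap hA

variable [MeasurableSingletonClass X]

lemma measurableSet_cyl (w : List X) (n : ℕ) : MeasurableSet (cyl w n) := by
  have : cyl w n = ⋂ k : Fin w.length, (fun ω : ℤ → X => ω (((k : ℕ) : ℤ) - n)) ⁻¹' {w.get k} := by
    ext ω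
    simp [cyl]
  rw [this]
  exact MeasurableSet.iInter fun k => measurable_pi_apply _ (measurableSet_singleton _)

lemma measure_cyl {μ : Measure (ℤ → X)} (hstat : Stationary μ) (w : List X) (n : ℕ) :
    μ (cyl w n) = μ (cyl w 0) := by
  induction n with
  | zero => rfl
  | succ n ih =>
    rw [← ih]
    conv_lhs => rw [← hstat]
    rw [Measure.map_apply measurable_shift (measurableSet_cyl _ _)]
    congr 1
    ext ω
    simp only [cyl, shift, Set.mem_preimage, Set.mem_ofPred_eq]
    refine forall_congr' fun k => ?_
    rw [show ((k : ℕ) : ℤ) - ((n + 1 : ℕ) : ℤ) + 1 = ((k : ℕ) : ℤ) - n by push_cast; ring]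

lemma measure_cyl_eq_ofReal {μ : Measure (ℤ → X)} [IsProbabilityMeasure μ]
    (hstat : Stationary μ) (w : List X) (n : ℕ) :
    μ (cyl w n) = ENNReal.ofReal (wordProb μ w) := by
  rw [measure_cyl hstat, wordProb, ENNReal.ofReal_toReal (measure_ne_top _ _)]
  simp [cyl]

lemma wordProb_eq_real {μ : Measure (ℤ → X)} (hstat : Stationary μ) (w : List X) (n : ℕ) :
    wordProb μ w = μ.real (cyl w n) := by
  rw [measureReal_def, measure_cyl hstat]
  simp [wordProb, cyl]

lemma wordProb_append_le_left {μ : Measure (ℤ → X)} [IsProbabilityMeasure μ]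
    (hstat : Stationary μ) (v w : List X) : wordProb μ (v ++ w) ≤ wordProb μ v := by
  rw [wordProb_eq_real hstat _ v.length, wordProb_eq_real hstat v v.length]
  exact measureReal_mono fun ω hω => ((mem_cyl_append v w _ ω rfl).1 hω).1

lemma wordProb_append_le_right {μ : Measure (ℤ → X)} [IsProbabilityMeasure μ]
    (hstat : Stationary μ) (v w : List X) : wordProb μ (v ++ w) ≤ wordProb μ w := by
  rw [wordProb_eq_real hstat _ v.length, wordProb_eq_real hstat w 0]
  exact measureReal_mono fun ω hω => ((mem_cyl_append v w _ ω rfl).1 hω).2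

lemma condProb_le_one {μ : Measure (ℤ → X)} [IsProbabilityMeasure μ]
    (hstat : Stationary μ) (w v : List X) : condProb μ w v ≤ 1 :=
  div_le_one_of_le₀ (wordProb_append_le_left hstat v w) (wordProb_nonneg _ _)

lemma condProb_mul_wordProb {μ : Measure (ℤ → X)} [IsProbabilityMeasure μ]
    (hstat : Stationary μ) (w v : List X) :
    condProb μ w v * wordProb μ v = wordProb μ (v ++ w) := by
  by_cases h : wordProb μ v = 0
  · have h1 := wordProb_append_le_left hstat v w
    have h2 := wordProb_nonneg μ (v ++ w)
    rw [h] at h1 ⊢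
    linarith
  · exact div_mul_cancel₀ _ h

/-- Appending to a past a symbol of positive predicted probability divides the predicted
probabilities. -/
lemma extendPast_mem {μ : Measure (ℤ → X)} [IsProbabilityMeasure μ] (hstat : Stationary μ)
    {q : ℕ → X} {x : X} (hq : Regular μ q) (hx : 0 < predProb μ q [x]) :
    Nontrivial' μ (extendPast q x) ∧ ∀ w : List X,
      Tendsto (fun t => condProb μ w (pastWord (extendPast q x) t)) atTop
        (𝓝 (predProb μ q (x :: w) / predProb μ q [x])) := by
  have hpos : ∀ᶠ t in atTop, 0 < condProb μ [x] (pastWord q t) :=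
    (hq.tendsto (by simp)).eventually (lt_mem_nhds hx)
  have hstep : ∀ t, 0 < wordProb μ (pastWord (extendPast q x) (t + 1)) →
      0 < wordProb μ (pastWord (extendPast q x) t) := by
    intro t ht
    refine ht.trans_le ?_
    have : pastWord (extendPast q x) (t + 1) =
        [extendPast q x t] ++ pastWord (extendPast q x) t := by
      simp [pastWord, List.range_succ]
    rw [this]
    exact wordProb_append_le_right hstat _ _
  refine ⟨fun t => ?_, fun w => ?_⟩
  · obtain ⟨s, hs, hst⟩ := (hpos.and (eventually_ge_atTop t)).exists
    have hs' : 0 < wordProb μ (pastWord (extendPast q x) (s + 1)) := by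
      rw [pastWord_extendPast, ← condProb_mul_wordProb hstat]
      exact mul_pos hs (hq.1 s)
    exact Nat.decreasingInduction
      (motive := fun m _ => 0 < wordProb μ (pastWord (extendPast q x) m))
      (fun m _ hm => hstep m hm) hs' (Nat.le_succ_of_le hst)
  · rw [← tendsto_add_atTop_iff_nat 1]
    refine ((hq.tendsto (w := x :: w) (by simp)).div (hq.tendsto (by simp)) hx.ne').congr
      fun t => ?_
    rw [pastWord_extendPast]
    simp only [condProb, Pi.div_apply, List.append_assoc, List.singleton_append]
    exact div_div_div_cancel_right₀ (hq.1 t).ne' _ _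

lemma extendPast_mem_classOf {μ : Measure (ℤ → X)} [IsProbabilityMeasure μ]
    (hstat : Stationary μ) {p q : ℕ → X} {x : X} (hp : Regular μ p) (hq : q ∈ classOf μ p)
    (hx : 0 < predProb μ p [x]) : extendPast q x ∈ classOf μ (extendPast p x) := by
  have hxq : 0 < predProb μ q [x] := by rwa [hq.2 _ (by simp)]
  obtain ⟨hn, ht⟩ := extendPast_mem hstat hq.1 hxq
  rw [mem_classOf_iff]
  refine ⟨hn, fun w _ => ?_⟩
  have hlim : predProb μ (extendPast p x) w = predProb μ p (x :: w) / predProb μ p [x] :=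
    ((extendPast_mem hstat hp hx).2 w).limUnder_eq
  rw [hlim, ← hq.2 _ (by simp), ← hq.2 _ (by simp)]
  exact ht w

lemma measurableSet_next (x : X) : MeasurableSet {ω : ℤ → X | ω 0 = x} :=
  (measurable_pi_apply (0 : ℤ) : Measurable fun ω : ℤ → X => ω 0) (measurableSet_singleton x)

lemma indicator_predProb_eq_histT {μ : Measure (ℤ → X)} [IsProbabilityMeasure μ]
    (hstat : Stationary μ) {N : ℕ} {p : Fin N → (ℕ → X)} (hreg : ∀ i, Regular μ (p i))
    (x : X) (i j : Fin N) {q : ℕ → X} (hq : q ∈ classOf μ (p i)) :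
    {q | extendPast q x ∈ classOf μ (p j)}.indicator
      (fun q => ENNReal.ofReal (predProb μ q [x])) q = ENNReal.ofReal (histT μ p x i j) := by
  have hqx : predProb μ q [x] = predProb μ (p i) [x] := hq.2 _ (by simp)
  rcases ((hreg i).predProb_nonneg (w := [x]) (by simp)).eq_or_lt with h0 | hpos
  · simp [Set.indicator_apply, histT, hqx, ← h0]
  · have hmem := extendPast_mem_classOf hstat (hreg i) hq hpos
    have hiff : extendPast q x ∈ classOf μ (p j) ↔
        classOf μ (extendPast (p i) x) = classOf μ (p j) :=
      ⟨fun h => (classOf_eq_of_mem hmem).symm.trans (classOf_eq_of_mem h), fun h => h ▸ hmem⟩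
    by_cases h : classOf μ (extendPast (p i) x) = classOf μ (p j)
    · simp [histT, hqx, hpos, hiff, h]
    · simp [histT, hiff, h]

variable [Fintype X]

lemma measurable_comp_pastWord {β : Type*} [MeasurableSpace β] (f : List X → β) (t : ℕ) :
    Measurable (fun q : ℕ → X => f (pastWord q t)) := by
  simp_rw [pastWord_eq_ofFn]
  exact (measurable_of_countable
    (fun v : Fin t → X => f (List.ofFn v).reverse)).comp (measurable_initialSegment t)

lemma measurableSet_classOf (μ : Measure (ℤ → X)) (p : ℕ → X) :
    MeasurableSet (classOf μ p) := by
  have : classOf μ p = (⋂ t, {q | 0 < wordProb μ (pastWord q t)}) ∩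
      ⋂ w : List X, ⋂ _ : w ≠ [], {q | Tendsto (fun t => condProb μ w (pastWord q t)) atTop
        (𝓝 (predProb μ p w))} := by
    ext q
    rw [mem_classOf_iff]
    simp [Nontrivial']
  rw [this]
  refine (MeasurableSet.iInter fun t => ?_).inter
    (MeasurableSet.iInter fun w => MeasurableSet.iInter fun _ => ?_)
  · exact measurableSet_lt measurable_const (measurable_comp_pastWord _ t)
  · exact measurableSet_tendsto _ fun t => measurable_comp_pastWord _ t

lemma pastNextMeasure_map_initialSegment {μ : Measure (ℤ → X)} [IsProbabilityMeasure μ]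
    (hstat : Stationary μ) (x : X) (t : ℕ) :
    (pastNextMeasure μ x).map (initialSegment t) =
      ((pastMeasure μ).withDensity
        fun q => ENNReal.ofReal (condProb μ [x] (pastWord q t))).map (initialSegment t) := by
  refine Measure.ext_of_singleton fun v => ?_
  have hm : MeasurableSet (initialSegment t ⁻¹' ({v} : Set (Fin t → X))) :=
    measurable_initialSegment t (measurableSet_singleton v)
  rw [Measure.map_apply (measurable_initialSegment t) (measurableSet_singleton v),
    Measure.map_apply (measurable_initialSegment t) (measurableSet_singleton v),
    withDensity_apply _ hm]
  by_cases hne : ∃ q : ℕ → X, initialSegment t q = v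
  · obtain ⟨q, rfl⟩ := hne
    have hpast : pastMap ⁻¹' (initialSegment t ⁻¹' {initialSegment t q}) =
        cyl (pastWord q t) t := by
      ext ω
      simp [mem_cyl_pastWord]
    have hnext : pastMap ⁻¹' (initialSegment t ⁻¹' {initialSegment t q}) ∩ {ω | ω 0 = x} =
        cyl (pastWord q t ++ [x]) t := by
      rw [hpast]
      ext ω
      rw [mem_cyl_append _ _ _ _ (pastWord_length q t), mem_cyl_singleton]
      rfl
    rw [setLIntegral_congr_fun (g := fun _ => ENNReal.ofReal (condProb μ [x] (pastWord q t))) hm,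
      setLIntegral_const, pastNextMeasure_apply μ x hm, pastMeasure_apply μ hm, hnext, hpast,
      measure_cyl_eq_ofReal hstat, measure_cyl_eq_ofReal hstat,
      ← ENNReal.ofReal_mul (condProb_nonneg _ _ _), condProb_mul_wordProb hstat]
    intro r hr
    have hr' : initialSegment t r = initialSegment t q := hr
    simp only [pastWord_eq_ofFn, hr']
  · have : initialSegment t ⁻¹' ({v} : Set (Fin t → X)) = ∅ := by
      ext q
      simp only [Set.mem_preimage, Set.mem_singleton_iff, Set.mem_empty_iff_false, iff_false]
      exact fun h => hne ⟨q, h⟩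
    simp [this]

lemma pastNextMeasure_eq_withDensity {μ : Measure (ℤ → X)} [IsProbabilityMeasure μ]
    (hstat : Stationary μ) (x : X) (hreg : ∀ᵐ q ∂(pastMeasure μ), Regular μ q) :
    pastNextMeasure μ x =
      (pastMeasure μ).withDensity fun q => ENNReal.ofReal (predProb μ q [x]) := by
  have key : ∀ (s : ℕ) (S : Set (Fin s → X)),
      pastNextMeasure μ x (initialSegment s ⁻¹' S) =
      (pastMeasure μ).withDensity (fun q => ENNReal.ofReal (predProb μ q [x]))
        (initialSegment s ⁻¹' S) := by
    intro s S
    have hm : MeasurableSet (initialSegment s ⁻¹' S) :=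
      measurable_initialSegment s S.toFinite.measurableSet
    rw [withDensity_apply _ hm]
    have hlim := tendsto_lintegral_of_dominated_convergence
      (μ := (pastMeasure μ).restrict (initialSegment s ⁻¹' S))
      (F := fun t q => ENNReal.ofReal (condProb μ [x] (pastWord q t)))
      (f := fun q => ENNReal.ofReal (predProb μ q [x])) (fun _ => 1)
      (fun t => measurable_comp_pastWord (fun v => ENNReal.ofReal (condProb μ [x] v)) t)
      (fun t => Eventually.of_forall fun q =>
        ENNReal.ofReal_le_one.2 (condProb_le_one hstat _ _))
      (by simp)
      (ae_restrict_of_ae (hreg.mono fun q hq =>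
        (ENNReal.continuous_ofReal.tendsto _).comp (hq.tendsto (by simp))))
    refine tendsto_nhds_unique (tendsto_const_nhds.congr' ?_) hlim
    filter_upwards [eventually_ge_atTop s] with t hst
    have hpre : initialSegment s ⁻¹' S =
        initialSegment t ⁻¹' {v : Fin t → X | (fun k => v (Fin.castLE hst k)) ∈ S} := rfl
    rw [← withDensity_apply _ hm, hpre,
      ← Measure.map_apply (measurable_initialSegment t) (Set.toFinite _).measurableSet,
      pastNextMeasure_map_initialSegment hstat,
      Measure.map_apply (measurable_initialSegment t) (Set.toFinite _).measurableSet]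
  refine ext_of_generate_finite (measurableCylinders fun _ : ℕ => X)
    generateFrom_measurableCylinders.symm isPiSystem_measurableCylinders ?_ ?_
  · intro A hA
    obtain ⟨s, S, -, rfl⟩ := (mem_measurableCylinders A).1 hA
    obtain ⟨t, ht⟩ := s.exists_nat_subset_range
    exact key t {v | (fun k : s => v ⟨k, Finset.mem_range.1 (ht k.2)⟩) ∈ S}
  · exact key 0 Set.univ

lemma pastMeasure_eq_sum {μ : Measure (ℤ → X)} (hstat : Stationary μ) {A : Set (ℕ → X)}
    (hA : MeasurableSet A) :
    pastMeasure μ A = ∑ x, pastNextMeasure μ x {q | extendPast q x ∈ A} := by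
  have hA' : MeasurableSet (shift ⁻¹' (pastMap ⁻¹' A) : Set (ℤ → X)) :=
    measurable_shift (measurable_pastMap hA)
  have hun : (shift ⁻¹' (pastMap ⁻¹' A) : Set (ℤ → X)) =
      ⋃ x, pastMap ⁻¹' {q | extendPast q x ∈ A} ∩ {ω | ω 0 = x} := by
    ext ω
    simp [pastMap_shift]
  rw [pastMeasure_apply μ hA]
  conv_lhs => rw [← hstat]
  rw [Measure.map_apply measurable_shift (measurable_pastMap hA), hun, measure_iUnion,
    tsum_fintype]
  · exact Finset.sum_congr rfl fun x _ =>
      (pastNextMeasure_apply μ x (measurable_extendPast x hA)).symm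
  · intro x y hxy
    refine Set.disjoint_left.2 fun ω hx hy => hxy ?_
    exact hx.2.symm.trans hy.2
  · exact fun x => (measurable_pastMap (measurable_extendPast x hA)).inter (measurableSet_next x)

end Helpers

/-- The distribution μ = (ℙ⁻(E_1),…,ℙ⁻(E_N)) is stationary for the
state-to-state transition matrix T = Σ_x T^(x) of the history ε-machine. -/
theorem history_mu_stationary
    {X : Type*} [Fintype X] [MeasurableSpace X] [MeasurableSingletonClass X]
    {N : ℕ} (μ : Measure (ℤ → X)) [IsProbabilityMeasure μ]
    (hstat : Stationary μ) (herg : Ergodic' μ)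
    (p : Fin N → (ℕ → X)) (hfc : FinitelyCharacterized μ p) :
    ∀ j : Fin N,
      ∑ i, (pastMeasure μ (classOf μ (p i))).toReal * totalT (histT μ p) i j
        = (pastMeasure μ (classOf μ (p j))).toReal := by
  intro j
  obtain ⟨hreg, hne, -, hsum⟩ := hfc
  have hmeas : ∀ i, MeasurableSet (classOf μ (p i)) := fun i => measurableSet_classOf μ (p i)
  have hdisj : Pairwise (Function.onFun Disjoint fun i => classOf μ (p i)) := fun i k hik =>
    Set.disjoint_left.2 fun q hi hk =>
      hne i k hik ((classOf_eq_of_mem hi).symm.trans (classOf_eq_of_mem hk))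
  have hcover : ∀ᵐ q ∂(pastMeasure μ), q ∈ ⋃ i, classOf μ (p i) := by
    refine (mem_ae_iff_prob_eq_one (MeasurableSet.iUnion hmeas)).2 ?_
    rw [measure_iUnion hdisj hmeas, tsum_fintype, hsum]
  have hae : ∀ᵐ q ∂(pastMeasure μ), Regular μ q := hcover.mono fun q hq => by
    obtain ⟨i, hi⟩ := Set.mem_iUnion.1 hq
    exact hi.1
  have hmain : pastMeasure μ (classOf μ (p j)) =
      ∑ x, ∑ i, ENNReal.ofReal (histT μ p x i j) * pastMeasure μ (classOf μ (p i)) := by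
    rw [pastMeasure_eq_sum hstat (hmeas j)]
    refine Finset.sum_congr rfl fun x _ => ?_
    have hA : MeasurableSet {q : ℕ → X | extendPast q x ∈ classOf μ (p j)} :=
      measurable_extendPast x (hmeas j)
    rw [pastNextMeasure_eq_withDensity hstat x hae, withDensity_apply _ hA,
      ← lintegral_indicator hA]
    conv_lhs => rw [← Measure.restrict_eq_self_of_ae_mem hcover]
    rw [lintegral_iUnion hmeas hdisj, tsum_fintype]
    refine Finset.sum_congr rfl fun i _ => ?_
    rw [← setLIntegral_const]
    exact setLIntegral_congr_fun (hmeas i) fun q hq =>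
      indicator_predProb_eq_histT hstat hreg x i j hq
  rw [hmain, Finset.sum_comm, ENNReal.toReal_sum fun i _ => ?_]
  · refine Finset.sum_congr rfl fun i _ => ?_
    rw [← Finset.sum_mul, ENNReal.toReal_mul, mul_comm, totalT_apply,
      ← ENNReal.ofReal_sum_of_nonneg fun x _ => histT_nonneg μ p x i j,
      ENNReal.toReal_ofReal (Finset.sum_nonneg fun x _ => histT_nonneg μ p x i j)]
  · exact ENNReal.sum_ne_top.2 fun x _ =>
      ENNReal.mul_ne_top ENNReal.ofReal_ne_top (measure_ne_top _ _)

end EM
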